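/- Let N ≥ 1 and let A be an associative unital ℂ-algebra containing elements aᵢ, aᵢ⁺, bᵢ, bᵢ⁺ (i = 1,…,N) with [aᵢ, aⱼ⁺] = δᵢⱼ, [bᵢ, bⱼ⁺] = δᵢⱼ, and all other pairs among these generators commuting. Define α^z_{ij} = i·(aᵢ⁺·aⱼ − aᵢ·aⱼ⁺ + δᵢⱼ), α^w_{ij} = i·(bᵢ⁺·bⱼ − bᵢ·bⱼ⁺ + δᵢⱼ), β_{ij} = i·(aᵢ⁺·bⱼ⁺ − aᵢ·bⱼ), and set α⁺_{ij} = α^z_{ij} + α^w_{ij}, α⁻_{ij} = α^z_{ij} − α^w_{ij}, β^S_{ij} = β_{ij} + β_{ji}, β^A_{ij} = β_{ij} − β_{ji}. Let 𝓔 = (i/2)·Σₖ (aₖ⁺·bₖ⁺ − aₖ·bₖ) be the total area operator. Then for all i, j: [𝓔, α⁺_{ij}] = 0, [𝓔, β^S_{ij}] = 0, [𝓔, α⁻_{ij}] = −i·β^A_{ij}, and [𝓔, β^A_{ij}] = −i·α⁻_{ij}. -/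

import Mathlib

theorem commutator_mul {A : Type*} [Ring A] (D x y : A) :
    D * (x * y) - x * y * D = (D * x - x * D) * y + x * (D * y - y * D) := by
  noncomm_ring

/-- The commutator of `(I / 2) • D` with `I • Y`. -/
theorem commutator_half_I_smul {A : Type*} [Ring A] [Algebra ℂ A] (D Y : A) :
    ((Complex.I / 2) • D) * (Complex.I • Y) - (Complex.I • Y) * ((Complex.I / 2) • D) =
      (-1 / 2 : ℂ) • (D * Y - Y * D) := by
  have h : Complex.I / 2 * Complex.I = -1 / 2 := by
    linear_combination (1 / 2 : ℂ) * Complex.I_mul_I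
  rw [smul_mul_smul_comm, smul_mul_smul_comm, mul_comm Complex.I, h, smul_sub]


/-- Area-preserving vs area-changing quantum deformations: the combinations
`α⁺ = α^z + α^w` and `β^S = β + βᵀ` commute with the total area operator `𝓔`, while
`[𝓔, α⁻] = −iβ^A` and `[𝓔, β^A] = −iα⁻`. -/
theorem stmt_19 (N : ℕ) (hN : 1 ≤ N) (A : Type*) [Ring A] [Algebra ℂ A]
    (a ad b bd : Fin N → A)
    (haad : ∀ i j, a i * ad j - ad j * a i = if i = j then 1 else 0)
    (hbbd : ∀ i j, b i * bd j - bd j * b i = if i = j then 1 else 0)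
    (haa : ∀ i j, a i * a j = a j * a i)
    (hadad : ∀ i j, ad i * ad j = ad j * ad i)
    (hbb : ∀ i j, b i * b j = b j * b i)
    (hbdbd : ∀ i j, bd i * bd j = bd j * bd i)
    (hab : ∀ i j, a i * b j = b j * a i)
    (habd : ∀ i j, a i * bd j = bd j * a i)
    (hadb : ∀ i j, ad i * b j = b j * ad i)
    (hadbd : ∀ i j, ad i * bd j = bd j * ad i)
    (αz αw β : Fin N → Fin N → A)
    (hαz : ∀ i j, αz i j = Complex.I • (ad i * a j - a i * ad j + if i = j then 1 else 0))
    (hαw : ∀ i j, αw i j = Complex.I • (bd i * b j - b i * bd j + if i = j then 1 else 0))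
    (hβ : ∀ i j, β i j = Complex.I • (ad i * bd j - a i * b j))
    (αp αm βS βA : Fin N → Fin N → A)
    (hαp : ∀ i j, αp i j = αz i j + αw i j)
    (hαm : ∀ i j, αm i j = αz i j - αw i j)
    (hβS : ∀ i j, βS i j = β i j + β j i)
    (hβA : ∀ i j, βA i j = β i j - β j i)
    (En : A)
    (hEn : En = (Complex.I / 2) • ∑ k, (ad k * bd k - a k * b k)) :
    ∀ i j,
      (En * αp i j - αp i j * En = 0) ∧
      (En * βS i j - βS i j * En = 0) ∧
      (En * αm i j - αm i j * En = -(Complex.I • βA i j)) ∧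
      (En * βA i j - βA i j * En = -(Complex.I • αm i j)) := by
  intro i j
  obtain ⟨D, hD⟩ : ∃ D, D = ∑ k, (ad k * bd k - a k * b k) := ⟨_, rfl⟩
  rw [← hD] at hEn
  have commutator_sum (x y : A)
      (f : Fin N → A) (h : ∀ k, (ad k * bd k - a k * b k) * x - x * (ad k * bd k - a k * b k) = f k)
      (hf : ∑ k, f k = y) : D * x - x * D = y := by
    rw [hD, Finset.sum_mul, Finset.mul_sum, ← Finset.sum_sub_distrib, ← hf]
    exact Finset.sum_congr rfl fun k _ => h k
  have hDa (i) : D * a i - a i * D = -bd i := by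
    refine commutator_sum _ _ (fun k => -((if i = k then 1 else 0) * bd k)) (fun k => ?_) (by simp)
    rw [← haad i k]
    linear_combination (norm := noncomm_ring) -(ad k * habd i k) + a k * hab i k - haa k i * b k
  have hDad (i) : D * ad i - ad i * D = -b i := by
    refine commutator_sum _ _ (fun k => -((if k = i then 1 else 0) * b k)) (fun k => ?_) (by simp)
    rw [← haad k i]
    linear_combination (norm := noncomm_ring) -(ad k * hadbd i k) + a k * hadb i k + hadad k i * bd k
  have hDb (i) : D * b i - b i * D = -ad i := by
    refine commutator_sum _ _ (fun k => -(ad k * (if i = k then 1 else 0))) (fun k => ?_) (by simp)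
    rw [← hbbd i k]
    linear_combination (norm := noncomm_ring) hadb k i * bd k - hab k i * b k - a k * hbb k i
  have hDbd (i) : D * bd i - bd i * D = -a i := by
    refine commutator_sum _ _ (fun k => -(a k * (if k = i then 1 else 0))) (fun k => ?_) (by simp)
    rw [← hbbd k i]
    linear_combination (norm := noncomm_ring) hadbd k i * bd k - habd k i * b k + ad k * hbdbd k i
  have hδ : (if j = i then 1 else 0 : A) = if i = j then 1 else 0 := by simp only [eq_comm]
  have haij := haad i j
  have haji := haad j i
  have hbij := hbbd i j
  have hbji := hbbd j i
  rw [hδ] at haji hbji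
  have hDδ : D * (if i = j then 1 else 0) - (if i = j then 1 else 0) * D = 0 := by
    split_ifs <;> simp
  simp only [hαp, hαm, hβS, hβA, hαz, hαw, hβ]
  generalize (if i = j then 1 else 0 : A) = δ at *
  have hz : D * (ad i * a j - a i * ad j + δ) - (ad i * a j - a i * ad j + δ) * D =
      -(ad i * bd j) - a j * b i + ad j * bd i + a i * b j := by
    have h₁ := commutator_mul D (ad i) (a j)
    have h₂ := commutator_mul D (a i) (ad j)
    rw [hDa, hDad] at h₁ h₂
    linear_combination (norm := noncomm_ring) h₁ - h₂ + hDδ + hab j i - hadbd j i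
  have hw : D * (bd i * b j - b i * bd j + δ) - (bd i * b j - b i * bd j + δ) * D =
      ad i * bd j + a j * b i - ad j * bd i - a i * b j := by
    have h₁ := commutator_mul D (bd i) (b j)
    have h₂ := commutator_mul D (b i) (bd j)
    rw [hDb, hDbd] at h₁ h₂
    linear_combination (norm := noncomm_ring) h₁ - h₂ + hDδ - hab j i + hadbd j i
  have hβD (i j) : D * (ad i * bd j - a i * b j) - (ad i * bd j - a i * b j) * D =
      -(b i * bd j) - ad i * a j + bd i * b j + a i * ad j := by
    have h₁ := commutator_mul D (ad i) (bd j)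
    have h₂ := commutator_mul D (a i) (b j)
    rw [hDad, hDbd] at h₁
    rw [hDa, hDb] at h₂
    linear_combination (norm := noncomm_ring) h₁ - h₂
  have hij := hβD i j
  have hji := hβD j i
  have half_two (x : A) : (-1 / 2 : ℂ) • (-(2 : ℂ) • x) = x := by module
  rw [hEn]
  simp only [← smul_add, ← smul_sub, commutator_half_I_smul, smul_smul, Complex.I_mul_I]
  refine ⟨?_, ?_, ?_, ?_⟩
  · convert smul_zero _ using 2
    linear_combination (norm := noncomm_ring) hz + hw
  · convert smul_zero _ using 2
    linear_combination (norm := noncomm_ring) hij + hji + haij + haji - hbij - hbji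
  · rw [neg_smul, one_smul, neg_neg]
    refine Eq.trans ?_ (half_two _)
    congr 1
    rw [neg_smul, two_smul]
    linear_combination (norm := noncomm_ring) hz - hw
  · rw [neg_smul, one_smul, neg_neg]
    refine Eq.trans ?_ (half_two _)
    congr 1
    rw [neg_smul, two_smul]
    linear_combination (norm := noncomm_ring) hij - hji - haij - haji + hbij + hbji
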